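/- arXiv:2302.13009 — 6 statements merged into one kernel-verified Lean document; each statement's English description precedes it below -/
import Mathlib

section
/- Let M be a positive integer, χ a Dirichlet character modulo M with values in ℂ, p a prime number, and κ ≥ 1 an integer. Then for every s ∈ ℂ with Re(s) > κ, the L-series of the coefficients of the p-stabilized Eisenstein series factors as Σ_{m=1}^{∞} σ^{{p}}_{κ−1,χ}(m)·m^{−s} = ζ(s)·(1 − χ(p)·p^{κ−1−s})·L(s−κ+1, χ), where ζ is the Riemann zeta function and L(·,χ) is the Dirichlet L-function of χ. (This is the identity L(s, E*_{κ,χ}) = ζ(s)·L^{{p}}(s−κ+1, χ).) -/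
open Finset

namespace DirichletCharacter

/-- The character of level `M * p` induced by `χ` vanishes off the integers coprime to `p`
and agrees with `χ` on them. -/
lemma changeLevel_mul_natCast {R : Type*} [CommRing R] {M : ℕ}
    (χ : DirichletCharacter R M) (p d : ℕ) :
    changeLevel (dvd_mul_right M p) χ (d : ZMod (M * p)) =
      if d.Coprime p then χ (d : ZMod M) else 0 := by
  by_cases hd : d.Coprime (M * p)
  · have h := changeLevel_eq_cast_of_dvd' χ (dvd_mul_right M p)
      (Nat.isCoprime_iff_coprime.mpr hd)
    rw [if_pos hd.coprime_mul_left_right]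
    simpa using h
  · rw [MulChar.map_nonunit _ (mt (ZMod.isUnit_iff_coprime d (M * p)).mp hd)]
    split_ifs with hdp
    · have hdM : ¬ d.Coprime M := fun h ↦ hd (h.mul_right hdp)
      exact (MulChar.map_nonunit _ (mt (ZMod.isUnit_iff_coprime d M).mp hdM)).symm
    · rfl

/-- Raising the level of `χ` from `M` to `M * p` removes the Euler factor at `p`. -/
lemma LFunction_changeLevel_mul_prime {M : ℕ} [NeZero M] (χ : DirichletCharacter ℂ M)
    {p : ℕ} [NeZero (M * p)] (hp : p.Prime) {s : ℂ} (h : χ ≠ 1 ∨ s ≠ 1) :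
    LFunction (changeLevel (dvd_mul_right M p) χ) s =
      (1 - χ (p : ZMod M) * (p : ℂ) ^ (-s)) * LFunction χ s := by
  rw [LFunction_changeLevel (dvd_mul_right M p) χ h, mul_comm]
  congr 1
  refine Finset.prod_eq_single_of_mem p ?_ fun q hq hqp ↦ ?_
  · exact Nat.mem_primeFactors.mpr ⟨hp, dvd_mul_left p M, NeZero.ne _⟩
  · obtain ⟨hq, hqd, -⟩ := Nat.mem_primeFactors.mp hq
    have hqM : q ∣ M := (hq.dvd_mul.mp hqd).resolve_right
      fun h ↦ hqp ((Nat.prime_dvd_prime_iff_eq hq hp).mp h)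
    have hcop : ¬ q.Coprime M := fun h ↦ hq.coprime_iff_not_dvd.mp h hqM
    rw [MulChar.map_nonunit _ (mt (ZMod.isUnit_iff_coprime q M).mp hcop)]
    simp

end DirichletCharacter

namespace LSeries

/-- Multiplying coefficients by `n ^ k` shifts the terms of an L-series by `k`. -/
lemma term_mul_natCast_pow (f : ℕ → ℂ) (k : ℕ) (s : ℂ) :
    term (fun n ↦ f n * (n : ℂ) ^ k) s = term f (s - k) := by
  ext n
  rcases eq_or_ne n 0 with rfl | hn
  · simp
  · have hn' : (n : ℂ) ≠ 0 := Nat.cast_ne_zero.mpr hn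
    rw [term_of_ne_zero hn, term_of_ne_zero hn, Complex.cpow_sub _ _ hn', Complex.cpow_natCast,
      div_div_eq_mul_div]

/-- An L-series written as a sum over the positive integers. -/
lemma tsum_pnat_mul_cpow_neg (f : ℕ → ℂ) (s : ℂ) :
    ∑' m : ℕ+, f m * (m : ℂ) ^ (-s) = LSeries f s := by
  rw [LSeries, ← PNat.coe_injective.tsum_eq (f := term f s)]
  · refine tsum_congr fun m ↦ ?_
    rw [term_of_ne_zero m.ne_zero, Complex.cpow_neg, div_eq_mul_inv]
  · intro n hn
    rcases eq_or_ne n 0 with rfl | h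
    · exact absurd (term_zero f s) hn
    · exact ⟨⟨n, Nat.pos_of_ne_zero h⟩, rfl⟩

/-- Convolving with the constant sequence `1` sums over divisors. -/
lemma one_convolution_apply {R : Type*} [Semiring R] (g : ℕ → R) (n : ℕ) :
    convolution 1 g n = ∑ d ∈ n.divisors, g d := by
  simp only [convolution_def, Pi.one_apply, one_mul]
  exact Nat.sum_divisorsAntidiagonal' (fun _ d ↦ g d)

end LSeries


open Finset

/-- **L-function of the p-stabilized Eisenstein series.**
For `Re(s) > κ`, the Dirichlet series of the p-deprived twisted divisor sums factors as
`Σ_{m≥1} σ^{{p}}_{κ−1,χ}(m)·m^{−s} = ζ(s)·(1 − χ(p)p^{κ−1−s})·L(s−κ+1, χ)`,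
i.e. `L(s, E*_{κ,χ}) = ζ(s)·L^{{p}}(s−κ+1, χ)`. -/
theorem LSeries_p_stabilized_eisenstein
    (M : ℕ) [NeZero M] (χ : DirichletCharacter ℂ M)
    (p : ℕ) (hp : p.Prime) (κ : ℕ) (hκ : 1 ≤ κ)
    (s : ℂ) (hs : (κ : ℝ) < s.re) :
    ∑' m : ℕ+,
        (∑ d ∈ (m : ℕ).divisors.filter (fun d => Nat.Coprime d p),
          χ (d : ZMod M) * (d : ℂ) ^ (κ - 1)) * (m : ℂ) ^ (-s)
      = riemannZeta s * ((1 - χ (p : ZMod M) * (p : ℂ) ^ ((κ : ℂ) - 1 - s)) *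
          DirichletCharacter.LFunction χ (s - κ + 1)) := by
  have : NeZero (M * p) := ⟨mul_ne_zero (NeZero.ne M) hp.ne_zero⟩
  set ψ := DirichletCharacter.changeLevel (dvd_mul_right M p) χ with hψ
  let g : ℕ → ℂ := fun d ↦ ψ (d : ZMod (M * p)) * (d : ℂ) ^ (κ - 1)
  have hκs : s - κ + 1 = s - (κ - 1 : ℕ) := by
    push_cast [Nat.cast_sub hκ]
    ring
  have hre : 1 < (s - κ + 1).re := by
    simp only [Complex.add_re, Complex.sub_re, Complex.natCast_re, Complex.one_re]
    linarith
  have hs1 : 1 < s.re := lt_of_le_of_lt (by exact_mod_cast hκ) hs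
  have hterm : LSeries.term g s = LSeries.term (fun n ↦ ψ n) (s - κ + 1) := by
    rw [hκs]
    exact LSeries.term_mul_natCast_pow _ _ _
  have hgsum : LSeriesSummable g s := by
    rw [LSeriesSummable, hterm]
    exact ψ.LSeriesSummable_of_one_lt_re hre
  have hgL : LSeries g s = (1 - χ (p : ZMod M) * (p : ℂ) ^ ((κ : ℂ) - 1 - s)) *
      DirichletCharacter.LFunction χ (s - κ + 1) := by
    have hne : s - κ + 1 ≠ 1 := fun h ↦ by simp [h] at hre
    rw [LSeries, hterm, ← LSeries, ← ψ.LFunction_eq_LSeries hre,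
      DirichletCharacter.LFunction_changeLevel_mul_prime χ hp (.inr hne),
      show -(s - κ + 1) = (κ : ℂ) - 1 - s by ring]
  have hcoeff (m : ℕ) : ∑ d ∈ m.divisors.filter (fun d => Nat.Coprime d p),
      χ (d : ZMod M) * (d : ℂ) ^ (κ - 1) = LSeries.convolution 1 g m := by
    simp only [LSeries.one_convolution_apply, sum_filter, g, hψ,
      DirichletCharacter.changeLevel_mul_natCast χ p, ite_mul, zero_mul]
  simp only [hcoeff]
  rw [LSeries.tsum_pnat_mul_cpow_neg, LSeries_convolution' (LSeriesSummable_one_iff.mpr hs1) hgsum,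
    LSeries_one_eq_riemannZeta hs1, hgL]
end

section
/- Let p be an odd prime, M a positive integer, χ a Dirichlet character modulo M with values in ℚ_p, m a positive integer, and a a natural number. Then there exists a unique continuous function f : ℤ_p → ℚ_p such that for every integer κ ≥ 1 with κ ≡ a (mod p−1) one has f(κ) = Σ_{0<d∣m, gcd(d,p)=1} χ(d)·d^{κ−1}. (This is the p-adic interpolation of the higher Fourier coefficients σ^{{p}}_{κ−1,χ}(m) of the ordinarily p-stabilized Eisenstein series, as the weight κ varies p-adically in a fixed residue class modulo p−1.) -/
open Finset

section

variable {p : ℕ} [Fact p.Prime]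

lemma PadicInt.isUnit_natCast_prime_sub_one : IsUnit ((p - 1 : ℕ) : ℤ_[p]) := by
  rw [PadicInt.isUnit_iff]
  exact PadicInt.norm_natCast_p_sub_one

/-- The natural numbers `κ ≥ 1` in a fixed residue class mod `p - 1` are dense in `ℤ_[p]`. -/
lemma PadicInt.denseRange_natCast_modEq (a : ℕ) :
    DenseRange fun t : ℕ => ((a + (p - 1) * (t + 1) : ℕ) : ℤ_[p]) := by
  let h : ℤ_[p] → ℤ_[p] := fun s => a + ((p - 1 : ℕ) : ℤ_[p]) * (s + 1)
  have hc : Continuous h := by fun_prop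
  have hs : Function.Surjective h := fun x => by
    obtain ⟨u, hu⟩ := (isUnit_natCast_prime_sub_one (p := p)).exists_right_inv
    refine ⟨u * (x - a) - 1, ?_⟩
    simp only [h]
    linear_combination (x - a) * hu
  convert hs.denseRange.comp (denseRange_natCast (p := p)) hc using 1
  funext t
  simp only [h, Function.comp_apply]
  push_cast
  ring

/-- For `d` prime to `p`, the powers `d ^ (κ - 1)` with `κ` in a fixed residue class mod `p - 1`
interpolate to a continuous function of `κ`. -/
lemma PadicInt.exists_continuous_eq_pow_sub_one {d : ℕ} (hd : d.Coprime p) (a : ℕ) :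
    ∃ g : ℤ_[p] → ℚ_[p], Continuous g ∧
      ∀ κ : ℕ, 1 ≤ κ → κ ≡ a [MOD p - 1] → g κ = (d : ℚ_[p]) ^ (κ - 1) := by
  have hr : ‖((d : ℤ_[p]) ^ (p - 1) - 1)‖ < 1 := by
    have h := (Nat.ModEq.pow_card_sub_one_eq_one Fact.out hd).symm.dvd
    rw [← norm_int_lt_one_iff_dvd] at h
    simpa using h
  have hr' := tendsto_pow_atTop_nhds_zero_iff_norm_lt_one.mpr hr
  let ψ : AddChar ℤ_[p] ℤ_[p] := addChar_of_value_at_one _ hr'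
  have hψ : Continuous ψ := continuous_addChar_of_value_at_one hr'
  have hψ_nat (n : ℕ) : ψ n = (d : ℤ_[p]) ^ ((p - 1) * n) := by
    rw [← nsmul_one, AddChar.map_nsmul_eq_pow, addChar_of_value_at_one_def, pow_mul]
    congr 1
    ring
  have hd0 : (d : ℚ_[p]) ≠ 0 := by
    have := Padic.norm_natCast_eq_one_iff.mpr hd.symm
    rw [← norm_ne_zero_iff, this]
    exact one_ne_zero
  obtain ⟨u, hu⟩ := (isUnit_natCast_prime_sub_one (p := p)).exists_right_inv
  refine ⟨fun s => (d : ℚ_[p])⁻¹ * d ^ (a % (p - 1)) * (ψ (u * (s - (a % (p - 1) : ℕ))) : ℤ_[p]),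
    continuous_const.mul (continuous_subtype_val.comp (hψ.comp (by fun_prop))),
    fun κ hκ hκa => ?_⟩
  have hdecomp : κ = a % (p - 1) + (p - 1) * (κ / (p - 1)) := by
    rw [← show κ % (p - 1) = a % (p - 1) from hκa, Nat.mod_add_div]
  have harg : u * ((κ : ℤ_[p]) - (a % (p - 1) : ℕ)) = (κ / (p - 1) : ℕ) := by
    have := congrArg (Nat.cast : ℕ → ℤ_[p]) hdecomp
    rw [Nat.cast_add, Nat.cast_mul] at this
    linear_combination u * this + ((κ / (p - 1) : ℕ) : ℤ_[p]) * hu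
  simp only [harg, hψ_nat]
  rw [PadicInt.coe_pow, PadicInt.coe_natCast, mul_assoc, ← pow_add, ← hdecomp,
    inv_mul_eq_iff_eq_mul₀ hd0, ← pow_succ', Nat.sub_add_cancel hκ]

end

/-- **p-adic interpolation of the p-deprived twisted divisor sums.**
For an odd prime `p`, a Dirichlet character `χ` mod `M` valued in `ℚ_[p]`, a positive
integer `m` and `a : ℕ`, there is a unique continuous `f : ℤ_[p] → ℚ_[p]` with
`f(κ) = σ^{{p}}_{κ−1,χ}(m)` for all integers `κ ≥ 1` with `κ ≡ a (mod p−1)`. -/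
theorem padic_interpolation_p_deprived_divisor_sum
    (p : ℕ) [Fact p.Prime] (hp2 : p ≠ 2)
    (M : ℕ) (hM : 0 < M) (χ : DirichletCharacter ℚ_[p] M)
    (m : ℕ) (hm : 0 < m) (a : ℕ) :
    ∃! f : ℤ_[p] → ℚ_[p], Continuous f ∧
      ∀ κ : ℕ, 1 ≤ κ → κ ≡ a [MOD p - 1] →
        f (κ : ℤ_[p]) = ∑ d ∈ m.divisors.filter (fun d => Nat.Coprime d p),
          χ (d : ZMod M) * (d : ℚ_[p]) ^ (κ - 1) := by
  have hg (d : ℕ) (hd : d.Coprime p) := PadicInt.exists_continuous_eq_pow_sub_one hd a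
  choose! g hgc hg using hg
  refine existsUnique_of_exists_of_unique
    ⟨fun s => ∑ d ∈ m.divisors.filter (fun d => Nat.Coprime d p), χ (d : ZMod M) * g d s,
      ?_, fun κ hκ hκa => ?_⟩ ?_
  · exact continuous_finsetSum _ fun d hd =>
      continuous_const.mul (hgc d (mem_filter.mp hd).2)
  · exact sum_congr rfl fun d hd => by rw [hg d (mem_filter.mp hd).2 κ hκ hκa]
  · rintro f₁ f₂ ⟨hc₁, h₁⟩ ⟨hc₂, h₂⟩
    refine (PadicInt.denseRange_natCast_modEq a).equalizer hc₁ hc₂ (funext fun t => ?_)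
    have hp := (Fact.out : p.Prime).two_le
    have hpos : 1 ≤ a + (p - 1) * (t + 1) :=
      le_add_left (Nat.mul_pos (by lia) t.succ_pos)
    have hmod : a + (p - 1) * (t + 1) ≡ a [MOD p - 1] := by simp [Nat.ModEq]
    exact (h₁ _ hpos hmod).trans (h₂ _ hpos hmod).symm
end

section
/- Let p be an odd prime, M a positive integer, χ a Dirichlet character modulo M with values in ℚ_p, m a positive integer, and a a natural number. Then there exists a sequence c : ℕ → ℤ_p such that for every integer κ ≥ 1 with κ ≡ a (mod p−1), the family n ↦ c(n)·((1+p)^κ − 1)^n is summable in ℚ_p and Σ_{n=0}^{∞} c(n)·((1+p)^κ − 1)^n = Σ_{0<d∣m, gcd(d,p)=1} χ(d)·d^{κ−1}. (This realizes the m-th Fourier coefficient 𝒜_{χω^a}(m; X) of the Λ-adic Eisenstein series as an element of the Iwasawa algebra Λ = ℤ_p[χ][[X]], whose specialization at X = (1+p)^κ − 1 recovers σ^{{p}}_{κ−1,χ}(m).) -/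
open Finset

namespace PadicInt

variable {p : ℕ} [Fact p.Prime]

lemma exists_one_add_prime_pow_approx (hp2 : p ≠ 2) {u : ℤ_[p]} (hu : (p : ℤ_[p]) ∣ u - 1)
    (N : ℕ) : ∃ k : ℕ, (p : ℤ_[p]) ^ (N + 1) ∣ u - (1 + p) ^ k := by
  have hp : p.Prime := Fact.out
  have hp3 : 3 ≤ p := by have := hp.two_le; omega
  induction N with
  | zero => exact ⟨0, by simpa using hu⟩
  | succ N ih =>
    obtain ⟨k, w, hw⟩ := ih
    obtain ⟨y, hy⟩ := ZMod.exists_one_add_mul_pow_prime_pow_eq (R := ℤ_[p]) (u := p) (v := p) hp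
      dvd_rfl (by simpa [pow_succ] using pow_dvd_pow (p : ℤ_[p]) hp3) 1 N
    obtain ⟨j, -, hj⟩ := exists_mem_range w
    rw [maximalIdeal_eq_span_p, Ideal.mem_span_singleton] at hj
    obtain ⟨v, hv⟩ := hj
    obtain ⟨q, hq⟩ : (p : ℤ_[p]) ∣ (1 + p) ^ k - 1 := by
      simpa using sub_dvd_pow_sub_pow (1 + p : ℤ_[p]) 1 k
    obtain ⟨z, hz⟩ := Polynomial.powAddExpansion 1 ((p : ℤ_[p]) ^ N * p * (1 + p * y)) j
    rw [mul_one] at hy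
    refine ⟨k + p ^ N * j, v - q * j * (1 + p * y) - j * y -
      (1 + p) ^ k * z * p ^ N * (1 + p * y) ^ 2, ?_⟩
    rw [pow_add, pow_mul, hy, hz, one_pow, one_pow]
    linear_combination hw + p ^ (N + 1) * hv - j * p ^ (N + 1) * (1 + p * y) * hq

lemma tendsto_pow_of_prime_dvd {r : ℤ_[p]} (hr : (p : ℤ_[p]) ∣ r) :
    Filter.Tendsto (r ^ ·) Filter.atTop (nhds 0) :=
  tendsto_pow_atTop_nhds_zero_iff_norm_lt_one.mpr (norm_lt_one_iff_dvd r |>.mpr hr)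

/-- The continuous additive character `s ↦ (1 + p) ^ s` of `ℤ_[p]`. -/
noncomputable def oneAddPrimePow (p : ℕ) [Fact p.Prime] : AddChar ℤ_[p] ℤ_[p] :=
  addChar_of_value_at_one p (tendsto_pow_of_prime_dvd dvd_rfl)

lemma continuous_oneAddPrimePow : Continuous (oneAddPrimePow p) :=
  continuous_addChar_of_value_at_one _

lemma oneAddPrimePow_one : oneAddPrimePow p 1 = 1 + p :=
  addChar_of_value_at_one_def _

lemma oneAddPrimePow_natCast (k : ℕ) : oneAddPrimePow p k = (1 + p) ^ k := by
  rw [← nsmul_one, AddChar.map_nsmul_eq_pow, oneAddPrimePow_one]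

lemma exists_oneAddPrimePow_eq (hp2 : p ≠ 2) {u : ℤ_[p]} (hu : (p : ℤ_[p]) ∣ u - 1) :
    ∃ s, oneAddPrimePow p s = u := by
  have hclosed : IsClosed (Set.range (oneAddPrimePow p)) :=
    (isCompact_range continuous_oneAddPrimePow).isClosed
  change u ∈ Set.range (oneAddPrimePow p)
  rw [← hclosed.closure_eq, Metric.mem_closure_iff]
  intro ε hε
  obtain ⟨N, hN⟩ := exists_pow_neg_lt p hε
  obtain ⟨k, hk⟩ := exists_one_add_prime_pow_approx hp2 hu N
  refine ⟨_, ⟨k, rfl⟩, lt_of_le_of_lt ?_ hN⟩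
  rw [oneAddPrimePow_natCast, dist_eq_norm, norm_le_pow_iff_mem_span_pow,
    Ideal.mem_span_singleton]
  exact (pow_dvd_pow _ N.le_succ).trans hk

lemma hasSum_oneAddPrimePow_mul (s : ℤ_[p]) (κ : ℕ) :
    HasSum (fun n ↦ Ring.choose s n * ((1 + p : ℤ_[p]) ^ κ - 1) ^ n)
      (oneAddPrimePow p (κ * s)) := by
  have hr := tendsto_pow_of_prime_dvd (p := p) (r := (1 + p) ^ κ - 1)
    (by simpa using sub_dvd_pow_sub_pow (1 + p : ℤ_[p]) 1 κ)
  have hE : oneAddPrimePow p ^ κ = addChar_of_value_at_one _ hr := by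
    refine eq_addChar_of_value_at_one hr (κ := oneAddPrimePow p ^ κ) ?_ ?_
    · rw [AddChar.coe_pow]
      exact continuous_oneAddPrimePow.pow κ
    · rw [AddChar.pow_apply, oneAddPrimePow_one]
      ring
  have hval : oneAddPrimePow p (κ * s) = mahlerSeries (((1 + p : ℤ_[p]) ^ κ - 1) ^ ·) s := by
    rw [← coe_addChar_of_value_at_one hr, ← hE, AddChar.pow_apply, ← nsmul_eq_mul,
      AddChar.map_nsmul_eq_pow]
  rw [hval]
  simpa [mahlerTerm_apply, mahler_apply] using
    ContinuousMap.hasSum_apply (hasSum_mahlerSeries hr) s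

lemma exists_hasSum_pow_sub_one (hp2 : p ≠ 2) {d : ℕ} (hd : d.Coprime p) (a : ℕ) :
    ∃ c : ℕ → ℤ_[p], ∀ κ : ℕ, 1 ≤ κ → κ ≡ a [MOD p - 1] →
      HasSum (fun n ↦ c n * ((1 + p : ℤ_[p]) ^ κ - 1) ^ n) ((d : ℤ_[p]) ^ (κ - 1)) := by
  have hp : p.Prime := Fact.out
  have hp3 : 3 ≤ p := by have := hp.two_le; omega
  have hfermat : (p : ℤ_[p]) ∣ (d : ℤ_[p]) ^ (p - 1) - 1 := by
    have h := (Int.ModEq.pow_card_sub_one_eq_one hp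
      (Nat.isCoprime_iff_coprime.mpr hd)).symm.dvd
    simpa using map_dvd (Int.castRingHom ℤ_[p]) h
  obtain ⟨t, ht⟩ := exists_oneAddPrimePow_eq hp2 hfermat
  have hunit : IsUnit ((p - 1 : ℕ) : ℤ_[p]) := by
    rw [isUnit_iff, norm_natCast_eq_one_iff]
    exact (Nat.coprime_self_sub_right hp.one_le).mpr (Nat.coprime_one_right p)
  obtain ⟨s, rfl⟩ := hunit.dvd (a := t)
  set b := (a + (p - 2)) % (p - 1) with hb
  refine ⟨fun n ↦ d ^ b * oneAddPrimePow p (-((b + 1 : ℕ) * s)) * Ring.choose s n,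
    fun κ hκ hκa ↦ ?_⟩
  have hκb : (κ - 1) % (p - 1) = b := by
    have h := hκa.add_right (p - 2)
    rw [show κ + (p - 2) = κ - 1 + (p - 1) by omega] at h
    simpa [Nat.ModEq] using h
  set j := (κ - 1) / (p - 1) with hj
  have hdecomp : κ - 1 = b + (p - 1) * j := by
    rw [← hκb, hj, Nat.mod_add_div]
  have hcast : (κ : ℤ_[p]) = b + 1 + (p - 1 : ℕ) * j := by
    have h : κ = b + 1 + (p - 1) * j := by omega
    exact_mod_cast congrArg (Nat.cast (R := ℤ_[p])) h
  have hval : (d : ℤ_[p]) ^ (κ - 1) =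
      d ^ b * oneAddPrimePow p (-((b + 1 : ℕ) * s)) * oneAddPrimePow p (κ * s) := by
    rw [hdecomp, pow_add, pow_mul, ← ht, ← AddChar.map_nsmul_eq_pow, mul_assoc,
      ← AddChar.map_add_eq_mul, hcast, nsmul_eq_mul]
    congr 2
    push_cast
    ring
  rw [hval]
  simpa only [mul_assoc] using (hasSum_oneAddPrimePow_mul s κ).mul_left
    (d ^ b * oneAddPrimePow p (-((b + 1 : ℕ) * s)))

end PadicInt

/-- **Iwasawa-algebra realization of the Fourier coefficients of the Λ-adic
Eisenstein series.** For an odd prime `p`, a Dirichlet character `χ` mod `M` valued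
in `ℚ_[p]`, a positive integer `m` and `a : ℕ`, there is a power series
`c ∈ ℤ_p[[X]]` whose specialization at `X = (1+p)^κ − 1` converges to
`σ^{{p}}_{κ−1,χ}(m)` for every integer `κ ≥ 1` with `κ ≡ a (mod p−1)`. -/
theorem lambda_adic_fourier_coefficient_interpolation
    (p : ℕ) [Fact p.Prime] (hp2 : p ≠ 2)
    (M : ℕ) (hM : 0 < M) (χ : DirichletCharacter ℚ_[p] M)
    (m : ℕ) (hm : 0 < m) (a : ℕ) :
    ∃ c : ℕ → ℤ_[p],
      ∀ κ : ℕ, 1 ≤ κ → κ ≡ a [MOD p - 1] →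
        Summable (fun n : ℕ => (c n : ℚ_[p]) * ((1 + p : ℚ_[p]) ^ κ - 1) ^ n) ∧
        ∑' n : ℕ, (c n : ℚ_[p]) * ((1 + p : ℚ_[p]) ^ κ - 1) ^ n
          = ∑ d ∈ m.divisors.filter (fun d => Nat.Coprime d p),
              χ (d : ZMod M) * (d : ℚ_[p]) ^ (κ - 1) := by
  choose! c hc using fun (d : ℕ) (hd : d.Coprime p) ↦
    PadicInt.exists_hasSum_pow_sub_one (p := p) hp2 hd a
  have : NeZero M := ⟨hM.ne'⟩
  let x (d : ℕ) : ℤ_[p] := ⟨χ (d : ZMod M), χ.norm_le_one _⟩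
  refine ⟨fun n ↦ ∑ d ∈ m.divisors.filter (fun d => Nat.Coprime d p), x d * c d n,
    fun κ hκ hκa ↦ ?_⟩
  suffices h : HasSum (fun n : ℕ =>
      ((∑ d ∈ m.divisors.filter (fun d => Nat.Coprime d p), x d * c d n : ℤ_[p]) : ℚ_[p]) *
        ((1 + p : ℚ_[p]) ^ κ - 1) ^ n)
      (∑ d ∈ m.divisors.filter (fun d => Nat.Coprime d p),
        χ (d : ZMod M) * (d : ℚ_[p]) ^ (κ - 1)) from ⟨h.summable, h.tsum_eq⟩
  have h := hasSum_sum fun d (hd : d ∈ m.divisors.filter (fun d => Nat.Coprime d p)) ↦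
    (hc d (Finset.mem_filter.mp hd).2 κ hκ hκa).mul_left (x d)
  convert h.map (PadicInt.Coe.ringHom (p := p)) continuous_subtype_val using 1
  · funext n
    simp only [Function.comp_apply, ← mul_assoc, ← Finset.sum_mul, map_mul, map_pow, map_sub,
      map_add, map_one, map_natCast]
    rfl
  · simp only [map_sum, map_mul, map_pow, map_natCast]
    rfl
end

section
/- Let p be a prime and n ≥ 1 an integer. Then in the polynomial ring ℤ[X], the polynomial 𝒫_p^(n)(X,1) = (1 − p^n X)·∏_{i=1}^{⌊n/2⌋} (1 − p^{2n−2i+1} X²) divides the polynomial ℛ_p^(n)(X,1) = ∏_{j=1}^{n} (1 − p^{j(2n−j+1)/2} X^j). -/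
open Polynomial Finset

/-- The polynomial `𝒫_p^(n)(X,1) = (1 − p^n X)·∏_{i=1}^{⌊n/2⌋} (1 − p^{2n−2i+1} X²)` in `ℤ[X]`. -/
noncomputable def Ppoly (p n : ℕ) : Polynomial ℤ :=
  (1 - C ((p : ℤ) ^ n) * X) * ∏ i ∈ Icc 1 (n / 2), (1 - C ((p : ℤ) ^ (2 * n - 2 * i + 1)) * X ^ 2)

/-- The polynomial `ℛ_p^(n)(X,1) = ∏_{j=1}^{n} (1 − p^{j(2n−j+1)/2} X^j)` in `ℤ[X]`. -/
noncomputable def Rpoly (p n : ℕ) : Polynomial ℤ :=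
  ∏ j ∈ Icc 1 n, (1 - C ((p : ℤ) ^ (j * (2 * n - j + 1) / 2)) * X ^ j)

/-- `1 - a X²` divides `1 - aⁱ X²ⁱ`. -/
theorem one_sub_quadratic_dvd (a : ℤ) (i : ℕ) :
    (1 - C a * X ^ 2 : Polynomial ℤ) ∣ 1 - C (a ^ i) * X ^ (2 * i) := by
  rw [C_pow, pow_mul, ← mul_pow]
  simpa using sub_dvd_pow_sub_pow (1 : Polynomial ℤ) (C a * X ^ 2) i

/-- **Divisibility `𝒫_p^(n)(X,1) ∣ ℛ_p^(n)(X,1)`** in `ℤ[X]`, for a prime `p` and `n ≥ 1`. -/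
theorem Ppoly_dvd_Rpoly (p n : ℕ) (hp : p.Prime) (hn : 1 ≤ n) :
    Ppoly p n ∣ Rpoly p n := by
  have h_inj : Set.InjOn (fun i : ℕ => 2 * i) (Icc 1 (n / 2) : Finset ℕ) := by
    intro a _ b _ h
    dsimp only at h
    omega
  have h_notMem : 1 ∉ (Icc 1 (n / 2)).image (fun i => 2 * i) := by
    simp only [mem_image, not_exists, not_and]
    omega
  have h_subset : insert 1 ((Icc 1 (n / 2)).image (fun i => 2 * i)) ⊆ Icc 1 n := by
    intro j hj
    simp only [mem_insert, mem_image, mem_Icc] at hj ⊢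
    obtain rfl | ⟨i, hi, rfl⟩ := hj <;> omega
  unfold Ppoly Rpoly
  refine dvd_trans ?_ (prod_dvd_prod_of_subset _ _ _ h_subset)
  rw [prod_insert h_notMem, prod_image h_inj]
  refine mul_dvd_mul (dvd_of_eq ?_) (prod_dvd_prod_of_dvd _ _ fun i hi => ?_)
  · have h_exp : 1 * (2 * n - 1 + 1) / 2 = n := by omega
    rw [h_exp, pow_one]
  · have h_exp : 2 * i * (2 * n - 2 * i + 1) / 2 = (2 * n - 2 * i + 1) * i := by
      rw [mul_assoc, Nat.mul_div_cancel_left _ two_pos, mul_comm]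
    rw [h_exp, pow_mul]
    exact one_sub_quadratic_dvd _ i
end

section
/- Let p be a prime and ε an integer (in the application ε = ξ_p(−det T) ∈ {−1,0,1}). For natural numbers a, f define the polynomial G(a,f) ∈ ℤ[X] by G(a,f) = Σ_{i=0}^{a} (p²X)^i · ( Σ_{j≥0, i+j≤f} (p³X²)^j − ε·pX·Σ_{j≥0, i+j≤f−1} (p³X²)^j ), where empty sums are 0. Then for all natural numbers a and f one has G(a+2, f+2) − (p²X + p³X²)·G(a+1, f+1) + p⁵X³·G(a, f) = 1 − ε·pX. (Via Katsurada's explicit formula F_p(T;X) = G(𝔦(T), val_p(𝔣_T)) for a nondegenerate half-integral binary form T over ℤ_p, this is the genus-two local identity F_p(p²T;X) − (p²X+p³X²)F_p(pT;X) + p⁵X³F_p(T;X) = 1 − ξ_p(−det T)·pX used in the proof of the semi-ordinary p-stabilization theorem.) -/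
open Polynomial Finset

/-- Katsurada's explicit polynomial
`G(a,f) = Σ_{i=0}^{a} (p²X)^i·( Σ_{j≥0, i+j≤f} (p³X²)^j − ε·pX·Σ_{j≥0, i+j≤f−1} (p³X²)^j )`
in `ℤ[X]` (empty sums are `0`), so that `F_p(T;X) = G(𝔦(T), val_p(𝔣_T))` with
`ε = ξ_p(−det T)` for a nondegenerate half-integral binary form `T` over `ℤ_p`. -/
noncomputable def Gpoly (p : ℕ) (ε : ℤ) (a f : ℕ) : Polynomial ℤ :=
  ∑ i ∈ range (a + 1),
    (C ((p : ℤ) ^ 2) * X) ^ i *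
      ((∑ j ∈ range (f + 1 - i), (C ((p : ℤ) ^ 3) * X ^ 2) ^ j) -
        C ε * (C (p : ℤ) * X) * ∑ j ∈ range (f - i), (C ((p : ℤ) ^ 3) * X ^ 2) ^ j)

/-- Splitting off the `i = 0` term of `Gpoly` relates consecutive pairs of parameters. -/
lemma Gpoly_succ_succ (p : ℕ) (ε : ℤ) (a f : ℕ) :
    Gpoly p ε (a + 1) (f + 1) =
      C ((p : ℤ) ^ 2) * X * Gpoly p ε a f +
        ((∑ j ∈ range (f + 2), (C ((p : ℤ) ^ 3) * X ^ 2) ^ j) -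
          C ε * (C (p : ℤ) * X) * ∑ j ∈ range (f + 1), (C ((p : ℤ) ^ 3) * X ^ 2) ^ j) := by
  unfold Gpoly
  rw [sum_range_succ' _ (a + 1), mul_sum (range (a + 1))]
  refine congrArg₂ (· + ·) (sum_congr rfl fun i _ => ?_) ?_
  · rw [Nat.add_sub_add_right, Nat.add_sub_add_right, pow_succ', mul_assoc]
  · rw [pow_zero, one_mul, Nat.sub_zero, Nat.sub_zero]

/-- **The genus-two local identity**
`G(a+2,f+2) − (p²X + p³X²)·G(a+1,f+1) + p⁵X³·G(a,f) = 1 − ε·pX`, i.e.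
`F_p(p²T;X) − (p²X+p³X²)F_p(pT;X) + p⁵X³F_p(T;X) = 1 − ξ_p(−det T)·pX`. -/
theorem Gpoly_recurrence (p : ℕ) (hp : p.Prime) (ε : ℤ) (a f : ℕ) :
    Gpoly p ε (a + 2) (f + 2) -
        (C ((p : ℤ) ^ 2) * X + C ((p : ℤ) ^ 3) * X ^ 2) * Gpoly p ε (a + 1) (f + 1) +
        C ((p : ℤ) ^ 5) * X ^ 3 * Gpoly p ε a f
      = 1 - C ε * (C (p : ℤ) * X) := by
  rw [Gpoly_succ_succ p ε (a + 1) (f + 1), Gpoly_succ_succ p ε a f,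
    geom_sum_succ (n := f + 2), geom_sum_succ (n := f + 1)]
  simp only [C_pow]
  ring
end

section
/- Let r be a positive even integer and let A be a symmetric r × r matrix with integer entries all of whose diagonal entries are even. Then (−1)^{r/2}·det A is congruent to 0 or 1 modulo 4. (Applied to A = 2S for a half-integral symmetric matrix S of even degree r, this shows (−1)^{r/2}·𝔇_S ≡ 0 or 1 (mod 4), where 𝔇_S = 2^{2⌊r/2⌋}·det S, so that (−1)^{r/2}𝔇_S admits a decomposition 𝔡_S·𝔣_S² into a fundamental discriminant times a square.) -/
open Matrix

/-- Taking the Schur complement of an invertible block `P + Pᵀ` in a matrix of the form `L + Lᵀ`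
again produces a matrix of this form. -/
theorem exists_schur_complement_eq_add_transpose {R m n : Type*} [CommRing R]
    [Fintype m] [DecidableEq m] (P : Matrix m m R) (B : Matrix m n R)
    (Q : Matrix n n R) (hP : IsUnit (P + Pᵀ).det) :
    ∃ K : Matrix n n R, Q + Qᵀ - Bᵀ * (P + Pᵀ)⁻¹ * B = K + Kᵀ := by
  set M := P + Pᵀ with hM
  have hMt : Mᵀ = M := by rw [hM, transpose_add, transpose_transpose, add_comm]
  have hMit : (M⁻¹)ᵀ = M⁻¹ := by rw [transpose_nonsing_inv, hMt]
  have hcongr : M⁻¹ = M⁻¹ * P * M⁻¹ + M⁻¹ * Pᵀ * M⁻¹ := by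
    rw [← add_mul, ← mul_add, ← hM, nonsing_inv_mul _ hP, one_mul]
  refine ⟨Q - Bᵀ * (M⁻¹ * P * M⁻¹) * B, ?_⟩
  have hKt : (Bᵀ * (M⁻¹ * P * M⁻¹) * B)ᵀ = Bᵀ * (M⁻¹ * Pᵀ * M⁻¹) * B := by
    simp only [transpose_mul, transpose_transpose, hMit, Matrix.mul_assoc]
  rw [transpose_sub, hKt]
  conv_lhs => rw [hcongr, Matrix.mul_add, Matrix.add_mul]
  abel

theorem exists_det_add_transpose_eq_mul {R m n : Type*} [CommRing R]
    [Fintype m] [DecidableEq m] [Fintype n] [DecidableEq n] (L : Matrix (m ⊕ n) (m ⊕ n) R)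
    (hL : IsUnit (L.toBlocks₁₁ + L.toBlocks₁₁ᵀ).det) :
    ∃ K : Matrix n n R,
      (L + Lᵀ).det = (L.toBlocks₁₁ + L.toBlocks₁₁ᵀ).det * (K + Kᵀ).det := by
  obtain ⟨K, hK⟩ := exists_schur_complement_eq_add_transpose L.toBlocks₁₁
    (L.toBlocks₁₂ + L.toBlocks₂₁ᵀ) L.toBlocks₂₂ hL
  refine ⟨K, ?_⟩
  let := invertibleOfIsUnitDet _ hL
  have hblocks : L + Lᵀ = fromBlocks (L.toBlocks₁₁ + L.toBlocks₁₁ᵀ)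
      (L.toBlocks₁₂ + L.toBlocks₂₁ᵀ) (L.toBlocks₁₂ + L.toBlocks₂₁ᵀ)ᵀ
      (L.toBlocks₂₂ + L.toBlocks₂₂ᵀ) := by
    conv_lhs => rw [← fromBlocks_toBlocks L, fromBlocks_transpose, fromBlocks_add]
    rw [transpose_add, transpose_transpose, add_comm L.toBlocks₂₁]
  rw [hblocks, det_fromBlocks₁₁, invOf_eq_nonsing_inv, hK]

/-- A symmetric matrix over a linearly ordered index type whose diagonal entries are even
is the sum of a matrix and its transpose. -/
theorem Matrix.exists_eq_add_transpose {R n : Type*} [AddCommMonoid R] [LinearOrder n]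
    (A : Matrix n n R) (hsymm : Aᵀ = A) (hdiag : ∀ i, Even (A i i)) :
    ∃ L : Matrix n n R, A = L + Lᵀ := by
  choose d hd using hdiag
  refine ⟨of fun i j => if i < j then A i j else if i = j then d i else 0, ?_⟩
  ext i j
  have hij : A j i = A i j := congrFun (congrFun hsymm i) j
  rcases lt_trichotomy i j with h | rfl | h
  · simp [h, h.not_gt, h.ne']
  · simp [hd]
  · simp [h, h.not_gt, h.ne', hij]

theorem ZMod.neg_one_pow_mul_det_add_transpose (n : ℕ) :
    ∀ (ι : Type) [Fintype ι] [DecidableEq ι] (L : Matrix ι ι (ZMod 4)),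
      Fintype.card ι = 2 * n →
      (-1) ^ n * (L + Lᵀ).det = 0 ∨ (-1) ^ n * (L + Lᵀ).det = 1 := by
  induction n with
  | zero =>
    intro ι _ _ L hι
    have : IsEmpty ι := Fintype.card_eq_zero_iff.mp (by simpa using hι)
    simp
  | succ n ih =>
    intro ι _ _ L hι
    have h4 : (4 : ZMod 4) = 0 := by decide
    by_cases heven : ∀ i j, ∃ t : ZMod 4, (L + Lᵀ) i j = 2 * t
    · left
      choose t ht using heven
      have hA : L + Lᵀ = (2 : ZMod 4) • of t := by
        ext i j
        simpa using ht i j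
      rw [hA, det_smul, hι, show 2 * (n + 1) = 2 * n + 2 by ring, pow_add 2,
        show (2 : ZMod 4) ^ 2 = 0 by decide]
      simp
    push Not at heven
    obtain ⟨i, j, hodd⟩ := heven
    have hij : i ≠ j := by
      rintro rfl
      exact hodd (L i i) (by simp [two_mul])
    have hinj : Function.Injective ![i, j] := by
      intro a b hab
      fin_cases a <;> fin_cases b <;> simp_all
    let e : Fin 2 ⊕ ↥(Set.range ![i, j])ᶜ ≃ ι :=
      ((Equiv.ofInjective _ hinj).sumCongr (Equiv.refl _)).trans (Equiv.Set.sumCompl _)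
    have he : ∀ a, e (Sum.inl a) = ![i, j] a := fun a => by simp [e]
    set L' := L.submatrix e e with hL'
    have hdet : (L + Lᵀ).det = (L' + L'ᵀ).det := by
      rw [← det_submatrix_equiv_self e]
      rfl
    set P := L'.toBlocks₁₁ with hP
    have hPdet : (P + Pᵀ).det = -1 := by
      have hsq : ∀ x : ZMod 4, (∀ t, x ≠ 2 * t) → x * x = 1 := by decide
      have hx := hsq _ hodd
      have h00 : P 0 1 + P 1 0 = (L + Lᵀ) i j := by
        simp [hP, toBlocks₁₁, hL', he]
      rw [det_fin_two]
      simp only [Matrix.add_apply, transpose_apply]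
      rw [add_comm (P 1 0), h00, hx]
      linear_combination (P 0 0 * P 1 1) * h4
    have hunit : IsUnit (P + Pᵀ).det := by
      rw [hPdet]
      exact isUnit_one.neg
    obtain ⟨K, hK⟩ := exists_det_add_transpose_eq_mul L' hunit
    have hcard : Fintype.card ↥(Set.range ![i, j])ᶜ = 2 * n := by
      have := Fintype.card_congr e
      rw [Fintype.card_sum, Fintype.card_fin] at this
      omega
    have hprod : (L + Lᵀ).det = -(K + Kᵀ).det := by
      rw [hdet, hK, hPdet, neg_one_mul]
    have hsign : (-1) ^ (n + 1) * (L + Lᵀ).det = (-1) ^ n * (K + Kᵀ).det := by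
      rw [hprod]
      ring
    rw [hsign]
    exact ih _ K hcard

/-- **Discriminants of even symmetric matrices.** If `r` is a positive even integer and
`A` is a symmetric `r × r` integer matrix with even diagonal entries, then
`(−1)^{r/2}·det A ≡ 0 or 1 (mod 4)`. Applied to `A = 2S` for a half-integral symmetric
`S` of even degree `r`, this shows `(−1)^{r/2}·𝔇_S ≡ 0 or 1 (mod 4)`. -/
theorem even_symmetric_matrix_det_mod_four
    (r : ℕ) (hr : 0 < r) (hre : Even r) (A : Matrix (Fin r) (Fin r) ℤ)
    (hsymm : Aᵀ = A) (hdiag : ∀ i, Even (A i i)) :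
    (-1 : ℤ) ^ (r / 2) * A.det ≡ 0 [ZMOD 4] ∨
      (-1 : ℤ) ^ (r / 2) * A.det ≡ 1 [ZMOD 4] := by
  obtain ⟨L, rfl⟩ := A.exists_eq_add_transpose hsymm hdiag
  have hcast : (((L + Lᵀ).det : ℤ) : ZMod 4) =
      (L.map (Int.cast : ℤ → ZMod 4) + (L.map (Int.cast : ℤ → ZMod 4))ᵀ).det := by
    rw [Int.cast_det]
    congr 1
    ext i j
    simp
  have key := ZMod.neg_one_pow_mul_det_add_transpose (r / 2) (Fin r)
    (L.map (Int.cast : ℤ → ZMod 4)) (by rw [Fintype.card_fin, Nat.two_mul_div_two_of_even hre])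
  rw [← hcast] at key
  refine key.imp (fun h => ?_) (fun h => ?_) <;>
  · refine (ZMod.intCast_eq_intCast_iff _ _ 4).mp ?_
    rw [Int.cast_mul, Int.cast_pow, Int.cast_neg, Int.cast_one]
    simpa only [Int.cast_zero, Int.cast_one] using h
end
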